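/- (Rakha–Rathie extension of the Pfaff–Saalschütz summation, used and re-derived in the paper.) Let n be a nonnegative integer and a, b, c, p ∈ ℂ. Assume ab + p(c−a−b−1) ≠ 0 and set q = p(c−a−1)(c−b−1)/(ab + p(c−a−b−1)). Assume none of c, p, 2+a+b−c−n, q lies in {0, −1, …, −(n−1)}, and that (c)_n, (c−a−b−1)_n and (q)_n are nonzero. Then ₄F₃(a, b, p+1, −n; c, p, 2+a+b−c−n; 1) = (c−a−1)_n (c−b−1)_n (q+1)_n / ( (c)_n (c−a−b−1)_n (q)_n ). -/

import Mathlib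

/-- Rising factorial (Pochhammer symbol) `(a)ₖ = a(a+1)⋯(a+k−1)`. -/
noncomputable def poch (a : ℂ) (k : ℕ) : ℂ := (ascPochhammer ℂ k).eval a

/-- Terminating hypergeometric sum with numerator parameters `A` together with
the extra top parameter `-n`, denominator parameters `B`, and argument `x`. -/
noncomputable def hypTerm (A B : List ℂ) (n : ℕ) (x : ℂ) : ℂ :=
  ∑ k ∈ Finset.range (n + 1),
    ((A.map fun a => poch a k).prod * poch (-(n : ℂ)) k) /
      ((k.factorial : ℂ) * (B.map fun b => poch b k).prod) * x ^ k

open Finset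

theorem poch_zero (a : ℂ) : poch a 0 = 1 := by simp [poch]

theorem poch_succ (a : ℂ) (k : ℕ) : poch a (k + 1) = poch a k * (a + k) :=
  ascPochhammer_succ_eval k a

theorem poch_succ_left (a : ℂ) (k : ℕ) : poch a (k + 1) = a * poch (a + 1) k := by
  simp [poch, ascPochhammer_succ_left]

theorem poch_add (a : ℂ) (m k : ℕ) : poch a (m + k) = poch a m * poch (a + m) k := by
  induction k with
  | zero => simp [poch_zero]
  | succ k ih =>
    rw [← add_assoc, poch_succ, ih, poch_succ]
    push_cast
    ring

theorem poch_reflect (x : ℂ) (k : ℕ) : poch (1 - x - k) k = (-1) ^ k * poch x k := by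
  induction k with
  | zero => simp [poch_zero]
  | succ k ih =>
    rw [poch_succ_left, poch_succ,
      show 1 - x - ((k + 1 : ℕ) : ℂ) + 1 = 1 - x - k by push_cast; ring, ih]
    push_cast
    ring

theorem poch_neg_add (m k : ℕ) :
    poch (-((m + k : ℕ) : ℂ)) k = (-1) ^ k * (k.factorial * (m + k).choose k) := by
  have h : poch ((m + 1 : ℕ) : ℂ) k = k.factorial * (m + k).choose k := by
    rw [poch, ← ascPochhammer_eval_cast, ascPochhammer_nat_eq_ascFactorial,
      Nat.ascFactorial_eq_factorial_mul_choose, Nat.cast_mul]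
  rw [← h, ← poch_reflect]
  congr 1
  push_cast
  ring

theorem poch_ne_zero {a : ℂ} {n : ℕ} (h : ∀ m : ℕ, m < n → a ≠ -(m : ℂ)) : poch a n ≠ 0 := by
  induction n with
  | zero => simp [poch_zero]
  | succ n ih =>
    rw [poch_succ]
    exact mul_ne_zero (ih fun m hm => h m (by omega))
      fun h0 => h n n.lt_succ_self (eq_neg_of_add_eq_zero_left h0)

/-- The summand of the Pfaff–Saalschütz sum with denominators cleared; the sum is balanced
when `t = c - a - b`. -/
noncomputable def saalschutzTerm (a b c t : ℂ) (n k : ℕ) : ℂ :=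
  n.choose k * poch a k * poch b k * poch (c + k) (n - k) * poch t (n - k)

theorem sum_saalschutzTerm_telescope (a b c : ℂ) (n K : ℕ) (hK : K ≤ n) :
    ∑ k ∈ range (K + 1), (saalschutzTerm a b c (c - a - b) (n + 1) k
        - (c - a + n) * (c - b + n) * saalschutzTerm a b c (c - a - b) n k)
      = -(n.choose K * poch a (K + 1) * poch b (K + 1) * poch (c + K) (n - K)
          * poch (c - a - b) (n - K)) := by
  induction K with
  | zero =>
    simp only [saalschutzTerm, zero_add, sum_range_one, Nat.choose_zero_right, poch_zero,
      poch_succ, Nat.sub_zero, Nat.cast_zero, Nat.cast_one, add_zero]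
    ring
  | succ K ih =>
    obtain ⟨m, rfl⟩ := Nat.exists_eq_add_of_le hK
    rw [sum_range_succ, ih (by omega)]
    have h1 : K + 1 + m + 1 - (K + 1) = m + 1 := by omega
    have h2 : K + 1 + m - (K + 1) = m := by omega
    have h3 : K + 1 + m - K = m + 1 := by omega
    have hch : ((K + 1 + m).choose (K + 1) : ℂ) * (K + 1) = (K + 1 + m).choose K * (m + 1) := by
      have := Nat.choose_succ_right_eq (K + 1 + m) K
      rw [h3] at this
      exact_mod_cast this
    simp only [saalschutzTerm, h1, h2, h3, Nat.choose_succ_succ']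
    rw [poch_succ_left (c + K), poch_succ (c + _), poch_succ (c - a - b), poch_succ a (K + 1),
      poch_succ b (K + 1)]
    push_cast
    rw [← add_assoc c (K : ℂ) 1]
    linear_combination (-(poch a (K + 1) * poch b (K + 1) * poch (c + K + 1) m
      * poch (c - a - b) m * (c - a - b + m))) * hch

/-- The **Pfaff–Saalschütz summation** with denominators cleared. -/
theorem sum_saalschutzTerm (a b c : ℂ) (n : ℕ) :
    ∑ k ∈ range (n + 1), saalschutzTerm a b c (c - a - b) n k
      = poch (c - a) n * poch (c - b) n := by
  induction n with
  | zero => simp [saalschutzTerm, poch_zero]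
  | succ n ih =>
    have h := sum_saalschutzTerm_telescope a b c n n le_rfl
    rw [sum_sub_distrib, ← mul_sum, ih] at h
    rw [sum_range_succ, poch_succ (c - a), poch_succ (c - b)]
    simp only [saalschutzTerm, Nat.sub_self, poch_zero, Nat.choose_self] at h ⊢
    linear_combination h

theorem poch_sub_one_succ (t : ℂ) (m : ℕ) :
    poch (t - 1) (m + 1) = poch t (m + 1) - (m + 1) * poch t m := by
  rw [poch_succ_left, sub_add_cancel, poch_succ]
  ring

theorem sum_saalschutzTerm_sub_one (a b c : ℂ) (n : ℕ) :
    ∑ k ∈ range (n + 2), saalschutzTerm a b c (c - a - b - 1) (n + 1) k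
      = poch (c - a) n * poch (c - b) n
        * ((c - a - 1) * (c - b - 1) + (n + 1) * (c - a - b - 1)) := by
  have key : ∀ k ∈ range (n + 1), saalschutzTerm a b c (c - a - b - 1) (n + 1) k
      = saalschutzTerm a b c (c - a - b) (n + 1) k
        - (n + 1) * (c + n) * saalschutzTerm a b c (c - a - b) n k := by
    intro k hk
    obtain ⟨m, rfl⟩ := Nat.exists_eq_add_of_le (mem_range_succ_iff.mp hk)
    have h1 : k + m + 1 - k = m + 1 := by omega
    have hch : ((k + m + 1).choose k : ℂ) * (m + 1) = (k + m + 1) * (k + m).choose k := by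
      have := Nat.choose_mul_succ_eq (k + m) k
      rw [h1, mul_comm] at this
      exact_mod_cast this.symm
    simp only [saalschutzTerm, h1, Nat.add_sub_cancel_left]
    rw [poch_sub_one_succ, poch_succ (c + k)]
    push_cast
    linear_combination (-(poch a k * poch b k * poch (c + k) m * (c + k + m)
      * poch (c - a - b) m)) * hch
  have hP := sum_saalschutzTerm a b c (n + 1)
  rw [sum_range_succ] at hP ⊢
  rw [sum_congr rfl key, sum_sub_distrib, ← mul_sum, sum_saalschutzTerm]
  simp only [saalschutzTerm, Nat.sub_self, poch_zero, poch_succ] at hP ⊢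
  linear_combination hP

theorem sum_mul_saalschutzTerm (a b c t : ℂ) (n : ℕ) :
    ∑ k ∈ range (n + 2), (k : ℂ) * saalschutzTerm a b c t (n + 1) k
      = (n + 1) * a * b * ∑ k ∈ range (n + 1), saalschutzTerm (a + 1) (b + 1) (c + 1) t n k := by
  rw [sum_range_succ', mul_sum]
  simp only [Nat.cast_zero, zero_mul, add_zero]
  refine sum_congr rfl fun k _ => ?_
  have hch : ((n + 1).choose (k + 1) : ℂ) * (k + 1) = (n + 1) * n.choose k := by
    exact_mod_cast (Nat.add_one_mul_choose_eq n k).symm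
  simp only [saalschutzTerm, Nat.add_sub_add_right, poch_succ_left]
  rw [show c + ((k + 1 : ℕ) : ℂ) = c + 1 + k by push_cast; ring]
  push_cast
  linear_combination (a * poch (a + 1) k * (b * poch (b + 1) k) * poch (c + 1 + k) (n - k)
    * poch t (n - k)) * hch

theorem hypTerm_summand_eq {n k : ℕ} (hk : k ≤ n) (a b c s p : ℂ) (hp : p ≠ 0)
    (hpk : poch p k ≠ 0) (hc : poch c n ≠ 0) (hs : poch s n ≠ 0) :
    poch a k * (poch b k * poch (p + 1) k) * poch (-(n : ℂ)) k
        / (k.factorial * (poch c k * (poch p k * poch (1 - s - n) k)))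
      = (p + k) * saalschutzTerm a b c s n k / (p * poch c n * poch s n) := by
  obtain ⟨m, rfl⟩ := Nat.exists_eq_add_of_le' hk
  have hp1 : p * poch (p + 1) k = poch p k * (p + k) := by
    rw [← poch_succ_left, poch_succ]
  have hr : poch (1 - s - ((m + k : ℕ) : ℂ)) k = (-1) ^ k * poch (s + m) k := by
    rw [← poch_reflect]
    congr 1
    push_cast
    ring
  rw [add_comm m k, poch_add] at hc
  rw [poch_add] at hs
  have hc1 := left_ne_zero_of_mul hc
  have hc2 := right_ne_zero_of_mul hc
  have hs1 := left_ne_zero_of_mul hs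
  have hs2 := right_ne_zero_of_mul hs
  have hf : (k.factorial : ℂ) ≠ 0 := by exact_mod_cast k.factorial_ne_zero
  have hsgn : (-1 : ℂ) ^ k ≠ 0 := by simp
  rw [hr, poch_neg_add, saalschutzTerm, Nat.add_sub_cancel, poch_add s, add_comm m k,
    poch_add c, eq_div_of_mul_eq hp ((mul_comm _ _).trans hp1)]
  field_simp

theorem rakha_rathie (n : ℕ) (a b c p : ℂ)
    (hd : a * b + p * (c - a - b - 1) ≠ 0) (q : ℂ)
    (hq : q = p * (c - a - 1) * (c - b - 1) / (a * b + p * (c - a - b - 1)))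
    (hnd : ∀ z ∈ [c, p, 2 + a + b - c - (n : ℂ), q], ∀ m : ℕ, m < n → z ≠ -(m : ℂ))
    (hc : poch c n ≠ 0) (hcab : poch (c - a - b - 1) n ≠ 0) (hqn : poch q n ≠ 0) :
    hypTerm [a, b, p + 1] [c, p, 2 + a + b - c - (n : ℂ)] n 1
      = poch (c - a - 1) n * poch (c - b - 1) n * poch (q + 1) n /
          (poch c n * poch (c - a - b - 1) n * poch q n) := by
  rcases n with _ | n
  · simp [hypTerm, poch_zero]
  have hp : p ≠ 0 := by simpa using hnd p (by simp) 0 n.succ_pos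
  have hq0 : q ≠ 0 := by simpa using hnd q (by simp) 0 n.succ_pos
  have hqD : q * (a * b + p * (c - a - b - 1)) = p * (c - a - 1) * (c - b - 1) := by
    rw [hq, div_mul_cancel₀ _ hd]
  have hq1 : q * poch (q + 1) (n + 1) = poch q (n + 1) * (q + (n + 1)) := by
    rw [← poch_succ_left, poch_succ]
    push_cast
    ring
  have hsum : hypTerm [a, b, p + 1] [c, p, 2 + a + b - c - ((n + 1 : ℕ) : ℂ)] (n + 1) 1
      = (∑ k ∈ range (n + 2), (p + k) * saalschutzTerm a b c (c - a - b - 1) (n + 1) k)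
        / (p * poch c (n + 1) * poch (c - a - b - 1) (n + 1)) := by
    rw [hypTerm, sum_div]
    refine sum_congr rfl fun k hk => ?_
    have hk' := mem_range_succ_iff.mp hk
    rw [← hypTerm_summand_eq hk' a b c _ p hp
      (poch_ne_zero fun m hm => hnd p (by simp) m (by omega)) hc hcab,
      show 1 - (c - a - b - 1) - ((n + 1 : ℕ) : ℂ) = 2 + a + b - c - ((n + 1 : ℕ) : ℂ) by ring]
    simp
  have hbal := sum_saalschutzTerm (a + 1) (b + 1) (c + 1) n
  rw [show c + 1 - (a + 1) - (b + 1) = c - a - b - 1 by ring, add_sub_add_right_eq_sub,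
    add_sub_add_right_eq_sub] at hbal
  simp only [add_mul, sum_add_distrib] at hsum
  rw [← mul_sum, sum_saalschutzTerm_sub_one, sum_mul_saalschutzTerm, hbal] at hsum
  rw [hsum, poch_succ_left (c - a - 1), poch_succ_left (c - b - 1), sub_right_comm c a 1,
    sub_right_comm c b 1]
  simp only [sub_add_cancel, sub_right_comm c 1]
  rw [eq_div_of_mul_eq hq0 ((mul_comm _ _).trans hq1), div_eq_div_iff (by positivity) (by positivity)]
  field_simp
  linear_combination ((n + 1) * poch (c - a) n * poch (c - b) n) * hqD
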